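/- As n → ∞, S₁₁(n) ∼ C_s · I(n) · P(n) / n!, where C_s = (1/2) · e^{-(log 2)²/4}. -/

import Mathlib

open scoped BigOperators

/-- A zero-one matrix (entries in `Bool`) with no zero rows and no zero columns. -/
def IsIncidence {k l : ℕ} (M : Matrix (Fin k) (Fin l) Bool) : Prop :=
  (∀ i, ∃ j, M i j = true) ∧ (∀ j, ∃ i, M i j = true)

/-- The number of entries equal to one in a zero-one matrix. -/
def numOnes {k l : ℕ} (M : Matrix (Fin k) (Fin l) Bool) : ℕ :=
  (Finset.univ.filter fun p : Fin k × Fin l => M p.1 p.2 = true).card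

/-- `F₁₁₁₁ n`: the number of incidence matrices (of any size) with exactly `n` ones. -/
noncomputable def F1111 (n : ℕ) : ℕ :=
  Nat.card {A : Σ k l : ℕ, Matrix (Fin k) (Fin l) Bool //
    IsIncidence A.2.2 ∧ numOnes A.2.2 = n}

noncomputable def mIJ (i j n : ℕ) : ℕ :=
  Nat.card {M : Matrix (Fin i) (Fin j) Bool // IsIncidence M ∧ numOnes M = n}

/-- total preorders on `Fin n` -/
noncomputable def numPreorders (n : ℕ) : ℕ :=
  Nat.card {R : Fin n → Fin n → Prop //
    (∀ x, R x x) ∧ (∀ x y z, R x y → R y z → R x z) ∧ (∀ x y, R x y ∨ x = y ∨ R y x)}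

noncomputable def numPreordersWithBlocks (n k : ℕ) : ℕ :=
  Nat.card {R : Fin n → Fin n → Prop //
    ((∀ x, R x x) ∧ (∀ x y z, R x y → R y z → R x z) ∧ (∀ x y, R x y ∨ x = y ∨ R y x)) ∧
    Nat.card (Quot fun x y => R x y ∧ R y x) = k}

noncomputable def S11 (n : ℕ) : ℕ :=
  Nat.card {A : Σ k : ℕ, Matrix (Fin k) (Fin k) Bool //
    (∀ i j, A.2 i j = A.2 j i) ∧ IsIncidence A.2 ∧ numOnes A.2 = n}

def trSigma : (Σ k l : ℕ, Matrix (Fin k) (Fin l) Bool) → (Σ k l : ℕ, Matrix (Fin k) (Fin l) Bool) :=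
  fun A => ⟨A.2.1, A.1, A.2.2.transpose⟩

noncomputable def Phi11 (n : ℕ) : ℕ :=
  Nat.card (Quot fun x y : {A : Σ k l : ℕ, Matrix (Fin k) (Fin l) Bool //
    IsIncidence A.2.2 ∧ numOnes A.2.2 = n} => trSigma x.1 = y.1)

noncomputable def F1011 (n : ℕ) : ℕ :=
  Nat.card {A : Σ k l : ℕ, Matrix (Fin k) (Fin l) Bool //
    IsIncidence A.2.2 ∧ numOnes A.2.2 = n ∧
    ∀ i i' : Fin A.1, (∀ j, A.2.2 i j = A.2.2 i' j) → i = i'}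

noncomputable def F0001 (n : ℕ) : ℕ :=
  Nat.card (Quot fun x y : {A : Σ k l : ℕ, Matrix (Fin k) (Fin l) Bool //
      IsIncidence A.2.2 ∧ numOnes A.2.2 = n ∧
      ∀ i i' : Fin A.1, (∀ j, A.2.2 i j = A.2.2 i' j) → i = i'} =>
    ∃ σ : Equiv.Perm (Fin x.1.1), ∃ τ : Equiv.Perm (Fin x.1.2.1),
      y.1 = ⟨x.1.1, x.1.2.1, Matrix.of fun i j => x.1.2.2 (σ i) (τ j)⟩)

noncomputable def numInvolutions (n : ℕ) : ℕ :=
  Nat.card {σ : Equiv.Perm (Fin n) // σ * σ = 1}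

/-- number of cycles of a permutation, counting fixed points as cycles -/
def numCycles {n : ℕ} (σ : Equiv.Perm (Fin n)) : ℕ :=
  Multiset.card σ.cycleType + (n - σ.support.card)

/-- unsigned Stirling number of the first kind: permutations of `n` with `k` cycles -/
noncomputable def stirling1Unsigned (n k : ℕ) : ℕ :=
  Nat.card {σ : Equiv.Perm (Fin n) // numCycles σ = k}

/-- Stirling number of the second kind: partitions of an `n`-set into `k` blocks -/
noncomputable def stirling2 (n k : ℕ) : ℕ :=
  Nat.card {c : Setoid (Fin n) // Nat.card (Quotient c) = k}

noncomputable def sSym (k n : ℕ) : ℕ :=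
  Nat.card {M : Matrix (Fin k) (Fin k) Bool // (∀ a b, M a b = M b a) ∧ numOnes M = n}

noncomputable def muSym (i n : ℕ) : ℕ :=
  Nat.card {M : Matrix (Fin i) (Fin i) Bool //
    (∀ a b, M a b = M b a) ∧ IsIncidence M ∧ numOnes M = n}

open Filter Topology

lemma descFactorial_div_pow_eq_prod {N m : ℕ} (hN : 0 < N) (hm : m ≤ N) :
    (N.descFactorial m : ℝ) / (N : ℝ) ^ m = ∏ l ∈ Finset.range m, (1 - (l : ℝ) / N) := by
  have hN' : (N : ℝ) ≠ 0 := by positivity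
  rw [Nat.descFactorial_eq_prod_range, Nat.cast_prod,
    show (N : ℝ) ^ m = ∏ _l ∈ Finset.range m, (N : ℝ) by simp, ← Finset.prod_div_distrib]
  refine Finset.prod_congr rfl fun l hl => ?_
  rw [Nat.cast_sub ((Finset.mem_range.1 hl).le.trans hm)]
  field_simp

lemma exp_neg_div_one_sub_le {x : ℝ} (hx : x < 1) : Real.exp (-(x / (1 - x))) ≤ 1 - x := by
  have h : 0 < 1 - x := by linarith
  rw [← Real.le_log_iff_exp_le h]
  refine le_trans (le_of_eq ?_) (Real.one_sub_inv_le_log_of_pos h)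
  field_simp
  ring

lemma sum_range_cast_div (N m : ℕ) :
    ∑ l ∈ Finset.range m, (l : ℝ) / N = (m : ℝ) * (m - 1) / (2 * N) := by
  rw [← Finset.sum_div]
  have : ∑ l ∈ Finset.range m, (l : ℝ) = (m : ℝ) * (m - 1) / 2 := by
    induction m with
    | zero => simp
    | succ m ih => rw [Finset.sum_range_succ, ih]; push_cast; ring
  rw [this, div_div]

lemma descFactorial_div_pow_le_exp {N m : ℕ} (hN : 0 < N) (hm : m ≤ N) :
    (N.descFactorial m : ℝ) / (N : ℝ) ^ m ≤ Real.exp (-((m : ℝ) * (m - 1) / (2 * N))) := by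
  have hN' : (0 : ℝ) < N := by positivity
  rw [descFactorial_div_pow_eq_prod hN hm, ← sum_range_cast_div, ← Finset.sum_neg_distrib,
    Real.exp_sum]
  refine Finset.prod_le_prod (fun l hl => ?_) fun l _ => Real.one_sub_le_exp_neg _
  have : (l : ℝ) ≤ N := by exact_mod_cast (Finset.mem_range.1 hl).le.trans hm
  rw [sub_nonneg]
  exact div_le_one_of_le₀ this hN'.le

lemma exp_le_descFactorial_div_pow {N m : ℕ} (hm : m < N) :
    Real.exp (-((m : ℝ) * (m - 1) / (2 * N) / (1 - (m : ℝ) / N))) ≤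
      (N.descFactorial m : ℝ) / (N : ℝ) ^ m := by
  have hN : 0 < N := by lia
  have hN' : (0 : ℝ) < N := by positivity
  have hmN : (m : ℝ) / N < 1 := by rw [div_lt_one hN']; exact_mod_cast hm
  rw [descFactorial_div_pow_eq_prod hN hm.le, ← sum_range_cast_div, Finset.sum_div,
    ← Finset.sum_neg_distrib, Real.exp_sum]
  refine Finset.prod_le_prod (fun l _ => (Real.exp_pos _).le) fun l hl => ?_
  have hl' : (l : ℝ) / N ≤ (m : ℝ) / N := by
    have : (l : ℝ) ≤ m := by exact_mod_cast (Finset.mem_range.1 hl).le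
    gcongr
  refine le_trans ?_ (exp_neg_div_one_sub_le (hl'.trans_lt hmN))
  have h1 : 0 < 1 - (m : ℝ) / N := by linarith
  rw [Real.exp_le_exp, neg_le_neg_iff]
  gcongr

/-- The birthday-problem limit for falling factorials. -/
lemma tendsto_descFactorial_div_pow {ι : Type*} {l : Filter ι} {N m : ι → ℕ} {a : ℝ}
    (hN : ∀ᶠ x in l, 0 < N x)
    (h0 : Tendsto (fun x => (m x : ℝ) / N x) l (𝓝 0))
    (ha : Tendsto (fun x => (m x : ℝ) * (m x - 1) / (2 * N x)) l (𝓝 a)) :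
    Tendsto (fun x => ((N x).descFactorial (m x) : ℝ) / (N x : ℝ) ^ m x) l
      (𝓝 (Real.exp (-a))) := by
  have hlt : ∀ᶠ x in l, m x < N x := by
    filter_upwards [hN, h0.eventually (gt_mem_nhds one_pos)] with x hx hx'
    rw [div_lt_one (by positivity)] at hx'
    exact_mod_cast hx'
  have hlow : Tendsto (fun x => Real.exp (-((m x : ℝ) * (m x - 1) / (2 * N x) /
      (1 - (m x : ℝ) / N x)))) l (𝓝 (Real.exp (-a))) := by
    have := (ha.div (h0.const_sub 1) (by norm_num)).neg
    rw [sub_zero, div_one] at this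
    exact (Real.continuous_exp.tendsto _).comp this
  refine tendsto_of_tendsto_of_tendsto_of_le_of_le' hlow
    ((Real.continuous_exp.tendsto _).comp ha.neg) ?_ ?_
  · filter_upwards [hlt] with x hx using exp_le_descFactorial_div_pow hx
  · filter_upwards [hlt] with x hx using descFactorial_div_pow_le_exp (by lia) hx.le

lemma tendsto_one_sub_inv_pow {ι : Type*} {l : Filter ι} {k j : ι → ℕ} {a : ℝ}
    (hk : Tendsto (fun x => ((k x : ℝ))⁻¹) l (𝓝 0))
    (ha : Tendsto (fun x => (j x : ℝ) / k x) l (𝓝 a)) :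
    Tendsto (fun x => (1 - ((k x : ℝ))⁻¹) ^ j x) l (𝓝 (Real.exp (-a))) := by
  have hlow : Tendsto (fun x => Real.exp (-((j x : ℝ) / k x / (1 - ((k x : ℝ))⁻¹)))) l
      (𝓝 (Real.exp (-a))) := by
    have := (ha.div (hk.const_sub 1) (by norm_num)).neg
    rw [sub_zero, div_one] at this
    exact (Real.continuous_exp.tendsto _).comp this
  have hlt : ∀ᶠ x in l, ((k x : ℝ))⁻¹ < 1 := hk.eventually (gt_mem_nhds one_pos)
  refine tendsto_of_tendsto_of_tendsto_of_le_of_le' hlow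
    ((Real.continuous_exp.tendsto _).comp ha.neg) ?_ ?_
  · filter_upwards [hlt] with x hx
    calc _ = Real.exp (-((k x : ℝ)⁻¹ / (1 - ((k x : ℝ))⁻¹))) ^ j x := by
          rw [← Real.exp_nat_mul]; congr 1; ring
      _ ≤ _ := by gcongr; exact exp_neg_div_one_sub_le hx
  · filter_upwards [hlt] with x hx
    calc (1 - ((k x : ℝ))⁻¹) ^ j x ≤ Real.exp (-(k x : ℝ)⁻¹) ^ j x := by
          gcongr
          exact Real.one_sub_le_exp_neg _
      _ = _ := by rw [← Real.exp_nat_mul]; simp only [Function.comp]; congr 1; ring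

/-- The ratio between `C(k, i) C(C(k, 2), j)` and `k ^ i / i! * (k ^ 2 / 2) ^ j / j!`. -/
noncomputable def symRatio (k i j : ℕ) : ℝ :=
  (k.descFactorial i : ℝ) / (k : ℝ) ^ i *
    (((k.choose 2).descFactorial j : ℝ) / ((k : ℝ) ^ 2 / 2) ^ j)

lemma symRatio_nonneg (k i j : ℕ) : 0 ≤ symRatio k i j := by
  unfold symRatio; positivity

lemma symRatio_le_one (k i j : ℕ) : symRatio k i j ≤ 1 := by
  unfold symRatio
  refine mul_le_one₀ ?_ (by positivity) ?_
  · exact div_le_one_of_le₀ (by exact_mod_cast Nat.descFactorial_le_pow k i) (by positivity)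
  · refine div_le_one_of_le₀ ?_ (by positivity)
    calc ((k.choose 2).descFactorial j : ℝ) ≤ (k.choose 2 : ℝ) ^ j := by
          exact_mod_cast Nat.descFactorial_le_pow _ j
      _ ≤ _ := by
        gcongr
        rw [Nat.cast_choose_two]
        nlinarith [(Nat.cast_nonneg k : (0 : ℝ) ≤ k)]

lemma tendsto_symRatio {ι : Type*} {l : Filter ι} {n k i j : ι → ℕ} {c : ℝ} (hc : 0 < c)
    (hn : Tendsto n l atTop)
    (hk : Tendsto (fun x => (n x : ℝ) / k x) l (𝓝 c))
    (hi : Tendsto (fun x => (i x : ℝ) / √(n x)) l (𝓝 1))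
    (hij : ∀ᶠ x in l, i x + 2 * j x = n x) :
    Tendsto (fun x => symRatio (k x) (i x) (j x)) l (𝓝 (Real.exp (-(c + c ^ 2 / 4)))) := by
  have hnR : Tendsto (fun x => (n x : ℝ)) l atTop := tendsto_natCast_atTop_atTop.comp hn
  have hninv : Tendsto (fun x => ((n x : ℝ))⁻¹) l (𝓝 0) := tendsto_inv_atTop_zero.comp hnR
  have hsinv : Tendsto (fun x => (√(n x : ℝ))⁻¹) l (𝓝 0) :=
    tendsto_inv_atTop_zero.comp (Real.tendsto_sqrt_atTop.comp hnR)
  have hnpos : ∀ᶠ x in l, (0 : ℝ) < n x := hnR.eventually_gt_atTop 0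
  have hkpos : ∀ᶠ x in l, (0 : ℝ) < k x := by
    filter_upwards [hk.eventually (lt_mem_nhds hc)] with x hx
    rcases (Nat.cast_nonneg (k x) : (0 : ℝ) ≤ k x).eq_or_lt with h | h
    · rw [← h, div_zero] at hx; exact absurd hx (lt_irrefl _)
    · exact h
  have hkinv : Tendsto (fun x => ((k x : ℝ))⁻¹) l (𝓝 0) := by
    have := hk.mul hninv
    rw [mul_zero] at this
    refine this.congr' ?_
    filter_upwards [hnpos] with x hx
    field_simp
  have hik : Tendsto (fun x => (i x : ℝ) / k x) l (𝓝 0) := by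
    have := (hi.mul hk).mul hsinv
    rw [mul_zero] at this
    refine this.congr' ?_
    filter_upwards [hnpos, hkpos] with x hx hx'
    have := Real.sq_sqrt hx.le
    have h0 : 0 < √(n x : ℝ) := Real.sqrt_pos.2 hx
    field_simp
    rw [this]
  have hi2 : Tendsto (fun x => (i x : ℝ) * (i x - 1) / (2 * k x)) l (𝓝 (c / 2)) := by
    have := (((hi.pow 2).mul hk).sub hik).div_const 2
    rw [one_pow, one_mul, sub_zero] at this
    refine this.congr' ?_
    filter_upwards [hnpos, hkpos] with x hx hx'
    have := Real.sq_sqrt hx.le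
    rw [div_pow, this]
    field_simp
  have hjk : Tendsto (fun x => (j x : ℝ) / k x) l (𝓝 (c / 2)) := by
    have := (hk.sub hik).div_const 2
    rw [sub_zero] at this
    refine this.congr' ?_
    filter_upwards [hij, hkpos] with x hx hx'
    have : (n x : ℝ) = i x + 2 * j x := by exact_mod_cast hx.symm
    rw [this]; field_simp; ring
  have hNk : Tendsto (fun x => (1 - ((k x : ℝ))⁻¹) / 2) l (𝓝 (1 / 2)) := by
    simpa using (hkinv.const_sub 1).div_const 2
  have hk1 : ∀ᶠ x in l, 1 < k x := by
    filter_upwards [hkinv.eventually (gt_mem_nhds one_pos), hkpos] with x hx hx'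
    exact_mod_cast (inv_lt_one₀ hx').1 hx
  have hNe : ∀ᶠ x in l, ((k x).choose 2 : ℝ) = (k x : ℝ) ^ 2 * ((1 - ((k x : ℝ))⁻¹) / 2) := by
    filter_upwards [hkpos] with x hx
    rw [Nat.cast_choose_two]; field_simp
  have hN : ∀ᶠ x in l, 0 < (k x).choose 2 := by
    filter_upwards [hk1] with x hx using Nat.choose_pos hx
  have hjN : Tendsto (fun x => (j x : ℝ) / ((k x).choose 2 : ℕ)) l (𝓝 0) := by
    have := (hjk.mul hkinv).div hNk (by norm_num)
    rw [mul_zero, zero_div] at this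
    refine this.congr' ?_
    filter_upwards [hNe, hkpos] with x hx hx'
    rw [Pi.div_apply, hx, ← div_eq_mul_inv, div_div, div_div]; congr 1; ring
  have hj2 : Tendsto (fun x => (j x : ℝ) * (j x - 1) / (2 * ((k x).choose 2 : ℕ))) l
      (𝓝 (c ^ 2 / 4)) := by
    have := ((((hjk.pow 2).sub (hjk.mul hkinv)).div hNk (by norm_num))).div_const 2
    rw [mul_zero, sub_zero, show (c / 2) ^ 2 / (1 / 2) / 2 = c ^ 2 / 4 by ring] at this
    refine this.congr' ?_
    filter_upwards [hNe, hkpos] with x hx hx'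
    rw [Pi.div_apply, hx, ← div_eq_mul_inv, div_pow, div_div ( j x : ℝ), ← sq, ← sub_div, div_div,
      div_div]
    congr 1 <;> ring
  have h1 := tendsto_descFactorial_div_pow (hkpos.mono fun x hx => by exact_mod_cast hx) hik hi2
  have h2 := tendsto_descFactorial_div_pow hN hjN hj2
  have h3 := tendsto_one_sub_inv_pow hkinv hjk
  have := h1.mul (h2.mul h3)
  rw [← Real.exp_add, ← Real.exp_add,
    show -(c / 2) + (-(c ^ 2 / 4) + -(c / 2)) = -(c + c ^ 2 / 4) by ring] at this
  refine this.congr' ?_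
  filter_upwards [hNe, hkpos, hk1] with x hx hx' hx1
  unfold symRatio
  have h1x : (1 - ((k x : ℝ))⁻¹) ≠ 0 := by
    have : ((k x : ℝ))⁻¹ < 1 := (inv_lt_one₀ hx').2 (by exact_mod_cast hx1)
    linarith
  congr 1
  rw [hx, div_mul_eq_mul_div, mul_div_assoc, ← div_pow, div_eq_mul_inv _ (((k x : ℝ) ^ 2 / 2) ^ j x),
    ← inv_pow]
  congr 2
  generalize 1 - ((k x : ℝ))⁻¹ = u at h1x ⊢
  field_simp

/-- Pairs `(i, j)` with `i + 2 j = n`: involution types with `i` fixed points, `j` transpositions. -/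
def involutionTypes (n : ℕ) : Finset (ℕ × ℕ) :=
  (Finset.range (n + 1) ×ˢ Finset.range (n + 1)).filter fun p => p.1 + 2 * p.2 = n

lemma mem_involutionTypes {n : ℕ} {p : ℕ × ℕ} : p ∈ involutionTypes n ↔ p.1 + 2 * p.2 = n := by
  simp only [involutionTypes, Finset.mem_filter, Finset.mem_product, Finset.mem_range]
  lia

/-- The number of involutions of type `(i, j)`, divided by `(i + 2 j)!`. -/
noncomputable def involutionWeight (p : ℕ × ℕ) : ℝ :=
  ((p.1.factorial : ℝ) * p.2.factorial * 2 ^ p.2)⁻¹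

lemma involutionWeight_pos (p : ℕ × ℕ) : 0 < involutionWeight p := by
  unfold involutionWeight; positivity

noncomputable def involutionSum (n : ℕ) : ℝ := ∑ p ∈ involutionTypes n, involutionWeight p

lemma involutionSum_pos (n : ℕ) : 0 < involutionSum n :=
  Finset.sum_pos (fun p _ => involutionWeight_pos p) ⟨(n, 0), mem_involutionTypes.2 (by simp)⟩

lemma sum_fst_mul_involutionWeight (n : ℕ) (f : ℕ → ℝ) :
    ∑ p ∈ involutionTypes (n + 1), (p.1 : ℝ) * f p.1 * involutionWeight p =
      ∑ p ∈ involutionTypes n, f (p.1 + 1) * involutionWeight p := by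
  symm
  refine Finset.sum_of_injOn (fun p => (p.1 + 1, p.2)) ?_ ?_ ?_ ?_
  · rintro ⟨a, b⟩ _ ⟨c, d⟩ _ h
    simpa using h
  · intro p hp
    simp only [Finset.mem_coe, mem_involutionTypes] at hp ⊢
    lia
  · rintro ⟨_ | a, b⟩ hp hn
    · simp
    · refine absurd ⟨(a, b), ?_, rfl⟩ hn
      simp only [Finset.mem_coe, mem_involutionTypes] at hp ⊢
      lia
  · rintro ⟨a, b⟩ _
    have : ((a + 1 : ℕ) : ℝ) ≠ 0 := by positivity
    simp only [involutionWeight, Nat.factorial_succ, Nat.cast_mul]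
    field_simp

lemma sum_snd_mul_involutionWeight (n : ℕ) :
    ∑ p ∈ involutionTypes (n + 2), 2 * (p.2 : ℝ) * involutionWeight p = involutionSum n := by
  symm
  refine Finset.sum_of_injOn (fun p => (p.1, p.2 + 1)) ?_ ?_ ?_ ?_
  · rintro ⟨a, b⟩ _ ⟨c, d⟩ _ h
    simpa using h
  · intro p hp
    simp only [Finset.mem_coe, mem_involutionTypes] at hp ⊢
    lia
  · rintro ⟨a, _ | b⟩ hp hn
    · simp
    · refine absurd ⟨(a, b), ?_, rfl⟩ hn
      simp only [Finset.mem_coe, mem_involutionTypes] at hp ⊢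
      lia
  · rintro ⟨a, b⟩ _
    have : ((b + 1 : ℕ) : ℝ) ≠ 0 := by positivity
    simp only [involutionWeight, Nat.factorial_succ, Nat.cast_mul, pow_succ]
    field_simp

lemma involutionSum_mean (n : ℕ) :
    ∑ p ∈ involutionTypes (n + 1), (p.1 : ℝ) * involutionWeight p = involutionSum n := by
  simpa [involutionSum] using sum_fst_mul_involutionWeight n (fun _ => 1)

lemma involutionSum_rec (n : ℕ) :
    ((n + 2 : ℕ) : ℝ) * involutionSum (n + 2) = involutionSum (n + 1) + involutionSum n := by
  rw [← involutionSum_mean (n + 1), ← sum_snd_mul_involutionWeight n, ← Finset.sum_add_distrib,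
    involutionSum, Finset.mul_sum]
  refine Finset.sum_congr rfl fun p hp => ?_
  rw [← mem_involutionTypes.1 hp]; push_cast; ring

lemma involutionSum_second_moment (n : ℕ) :
    ∑ p ∈ involutionTypes (n + 1), (p.1 : ℝ) ^ 2 * involutionWeight p =
      ((n + 1 : ℕ) : ℝ) * involutionSum (n + 1) := by
  have h := sum_fst_mul_involutionWeight n (fun i => (i : ℝ))
  simp only [← sq] at h
  rw [h]
  rcases n with _ | n
  · have h0 : involutionTypes 0 = {(0, 0)} := by decide
    have h1 : involutionTypes 1 = {(1, 0)} := by decide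
    simp [involutionSum, h0, h1, involutionWeight]
  · rw [involutionSum_rec, ← involutionSum_mean n, add_comm, involutionSum,
      ← Finset.sum_add_distrib]
    refine Finset.sum_congr rfl fun p _ => ?_
    push_cast; ring

lemma involutionSum_variance (n : ℕ) :
    ∑ p ∈ involutionTypes (n + 1), ((p.1 : ℝ) - √(n + 1 : ℕ)) ^ 2 * involutionWeight p =
      2 * √(n + 1 : ℕ) * (√(n + 1 : ℕ) * involutionSum (n + 1) - involutionSum n) := by
  have hs : √((n + 1 : ℕ) : ℝ) ^ 2 = (n + 1 : ℕ) := Real.sq_sqrt (by positivity)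
  calc _ = ∑ p ∈ involutionTypes (n + 1), (p.1 : ℝ) ^ 2 * involutionWeight p
        - 2 * √(n + 1 : ℕ) * ∑ p ∈ involutionTypes (n + 1), (p.1 : ℝ) * involutionWeight p
        + √(n + 1 : ℕ) ^ 2 * involutionSum (n + 1) := by
          rw [involutionSum, Finset.mul_sum, Finset.mul_sum, ← Finset.sum_sub_distrib,
            ← Finset.sum_add_distrib]
          refine Finset.sum_congr rfl fun p _ => ?_
          ring
    _ = _ := by
      rw [involutionSum_second_moment, involutionSum_mean]
      linear_combination (-involutionSum (n + 1)) * hs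

lemma involutionSum_le (n : ℕ) :
    involutionSum n ≤ √(n + 1 : ℕ) * involutionSum (n + 1) := by
  have h := involutionSum_variance n
  have h0 : 0 ≤ ∑ p ∈ involutionTypes (n + 1),
      ((p.1 : ℝ) - √(n + 1 : ℕ)) ^ 2 * involutionWeight p :=
    Finset.sum_nonneg fun p _ => mul_nonneg (sq_nonneg _) (involutionWeight_pos p).le
  rw [h] at h0
  have hs : 0 < 2 * √((n + 1 : ℕ) : ℝ) := by positivity
  linarith [nonneg_of_mul_nonneg_right h0 hs]

/-- The number of fixed points of a random involution concentrates around `√n`. -/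
lemma sum_sq_sub_one_mul_involutionWeight_le {n : ℕ} (hn : 2 ≤ n) :
    ∑ p ∈ involutionTypes n, ((p.1 : ℝ) / √n - 1) ^ 2 * involutionWeight p ≤
      2 / √n * involutionSum n := by
  obtain ⟨m, rfl⟩ : ∃ m, n = m + 2 := ⟨n - 2, by lia⟩
  have hs : 0 < √((m + 2 : ℕ) : ℝ) := by positivity
  have hs2 : √((m + 2 : ℕ) : ℝ) ^ 2 = (m + 2 : ℕ) := Real.sq_sqrt (by positivity)
  have h1 : ∑ p ∈ involutionTypes (m + 2), ((p.1 : ℝ) / √(m + 2 : ℕ) - 1) ^ 2 * involutionWeight p =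
      (∑ p ∈ involutionTypes (m + 2), ((p.1 : ℝ) - √(m + 2 : ℕ)) ^ 2 * involutionWeight p) /
        √(m + 2 : ℕ) ^ 2 := by
    rw [Finset.sum_div]
    refine Finset.sum_congr rfl fun p _ => ?_
    field_simp
  rw [h1, involutionSum_variance (m + 1)]
  have h2 := involutionSum_le m
  have h3 : √((m + 1 : ℕ) : ℝ) ≤ √((m + 2 : ℕ) : ℝ) := by
    apply Real.sqrt_le_sqrt; push_cast; linarith
  have h4 := involutionSum_rec m
  have h5 := involutionSum_pos (m + 1)
  have h6 := involutionSum_pos (m + 2)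
  change 2 * √((m + 2 : ℕ) : ℝ) * (√((m + 2 : ℕ) : ℝ) * involutionSum (m + 2) - involutionSum (m + 1)) /
        √(m + 2 : ℕ) ^ 2 ≤ _
  rw [← hs2] at h4
  set s := √((m + 2 : ℕ) : ℝ)
  have h7 : involutionSum m ≤ s * involutionSum (m + 1) := h2.trans (by gcongr)
  have h8 : s * involutionSum (m + 2) - involutionSum (m + 1) ≤ involutionSum (m + 2) := by
    have : s ^ 2 * involutionSum (m + 2) ≤ (1 + s) * involutionSum (m + 1) := by linarith
    by_contra! hlt
    nlinarith
  rw [show 2 * s * (s * involutionSum (m + 2) - involutionSum (m + 1)) / s ^ 2 =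
    2 / s * (s * involutionSum (m + 2) - involutionSum (m + 1)) by field_simp]
  gcongr

/-- The unnormalised weight of `k` in the series `∑ k ^ n / 2 ^ (k + 1)`. -/
noncomputable def geomWeight (n k : ℕ) : ℝ := (k : ℝ) ^ n / 2 ^ (k + 1)

lemma geomWeight_nonneg (n k : ℕ) : 0 ≤ geomWeight n k := by unfold geomWeight; positivity

lemma summable_geomWeight (n : ℕ) : Summable (geomWeight n) := by
  have h := (summable_pow_mul_geometric_of_norm_lt_one (R := ℝ) n (r := 1 / 2)
    (by norm_num)).mul_right (1 / 2)
  refine h.congr fun k => ?_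
  rw [geomWeight, pow_succ, one_div_pow]
  field_simp

noncomputable def geomSum (n : ℕ) : ℝ := ∑' k, geomWeight n k

lemma hasSum_geomWeight (n : ℕ) : HasSum (geomWeight n) (geomSum n) :=
  (summable_geomWeight n).hasSum

lemma geomSum_pos (n : ℕ) : 0 < geomSum n :=
  (summable_geomWeight n).tsum_pos (geomWeight_nonneg n) 1 (by unfold geomWeight; positivity)

/-- A nonnegative quantity that vanishes when `(1 + 1 / k) ^ n = 2`. -/
noncomputable def geomDeviation (n k : ℕ) : ℝ :=
  ((1 + (k : ℝ)⁻¹) ^ n - 2) ^ 2 / (2 * (1 + (k : ℝ)⁻¹) ^ n)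

lemma geomDeviation_nonneg (n k : ℕ) : 0 ≤ geomDeviation n k := by
  unfold geomDeviation; positivity

lemma geomDeviation_le {n k : ℕ} (hn : 2 ≤ n) (hk : 1 ≤ k) :
    geomDeviation n k ≤
      (1 + (k : ℝ)⁻¹) ^ n / 2 + 2 * (1 - (k : ℝ)⁻¹) ^ n - 2 + 4 / ((n : ℝ) - 1) := by
  have hk' : (1 : ℝ) ≤ k := by exact_mod_cast hk
  have hn' : (2 : ℝ) ≤ n := by exact_mod_cast hn
  have hu0 : 0 < (k : ℝ)⁻¹ := by positivity
  have hu1 : (k : ℝ)⁻¹ ≤ 1 := inv_le_one_of_one_le₀ hk'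
  unfold geomDeviation
  generalize (k : ℝ)⁻¹ = u at *
  have hX : 0 < (1 + u) ^ n := by positivity
  have hbin : (n : ℝ) * (n - 1) / 2 * u ^ 2 ≤ (1 + u) ^ n := by
    rw [add_comm, add_pow, ← Nat.cast_choose_two]
    have := Finset.single_le_sum (f := fun m => u ^ m * 1 ^ (n - m) * (n.choose m : ℝ))
      (fun m _ => by positivity) (Finset.mem_range.2 (show 2 < n + 1 by lia))
    simp only [one_pow, mul_one] at this ⊢
    linarith
  have hprod : 1 - n * u ^ 2 ≤ (1 + u) ^ n * (1 - u) ^ n := by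
    have := one_add_mul_le_pow (show -2 ≤ -u ^ 2 by nlinarith) n
    rw [← mul_pow, show (1 + u) * (1 - u) = 1 + -u ^ 2 by ring]
    linarith
  generalize (1 + u) ^ n = X at *
  generalize (1 - u) ^ n = Z at *
  have hn1 : (0 : ℝ) < n - 1 := by linarith
  have hgoal : X ^ 2 + 4 ≤ X ^ 2 + 4 * (X * Z) + 4 / ((n : ℝ) - 1) * (2 * X) := by
    have h1 : (n : ℝ) * u ^ 2 ≤ 2 / (n - 1) * X := by
      rw [div_mul_eq_mul_div, le_div_iff₀ hn1]
      linarith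
    have h2 : 4 / ((n : ℝ) - 1) * (2 * X) = 4 * (2 / (n - 1) * X) := by ring
    linarith
  rw [div_le_iff₀ (by positivity)]
  nlinarith

lemma geomWeight_mul_geomDeviation_le {n : ℕ} (hn : 2 ≤ n) (k : ℕ) :
    geomWeight n k * geomDeviation n k ≤
      geomWeight n (k + 1) + ((k - 1 : ℕ) : ℝ) ^ n / 2 ^ k - 2 * geomWeight n k
        + 4 / ((n : ℝ) - 1) * geomWeight n k := by
  rcases Nat.eq_zero_or_pos k with rfl | hk
  · have : geomWeight n 0 = 0 := by simp [geomWeight, show n ≠ 0 by lia]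
    rw [this]
    have := geomWeight_nonneg n (0 + 1)
    have h2 : 0 ≤ ((0 - 1 : ℕ) : ℝ) ^ n / 2 ^ 0 := by positivity
    linarith
  · have hk0 : (k : ℝ) ≠ 0 := by positivity
    refine (mul_le_mul_of_nonneg_left (geomDeviation_le hn hk) (geomWeight_nonneg n k)).trans
      (le_of_eq ?_)
    have h1 : geomWeight n (k + 1) = geomWeight n k * ((1 + (k : ℝ)⁻¹) ^ n / 2) := by
      have : ((k + 1 : ℕ) : ℝ) = k * (1 + (k : ℝ)⁻¹) := by push_cast; field_simp
      rw [geomWeight, geomWeight, this, mul_pow]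
      ring
    have h2 : ((k - 1 : ℕ) : ℝ) ^ n / 2 ^ k = geomWeight n k * (2 * (1 - (k : ℝ)⁻¹) ^ n) := by
      have : ((k - 1 : ℕ) : ℝ) = k * (1 - (k : ℝ)⁻¹) := by
        rw [Nat.cast_sub hk]; push_cast; field_simp
      rw [geomWeight, this, mul_pow, pow_succ]
      field_simp
    rw [h1, h2]
    ring

lemma hasSum_geomWeight_bound {n : ℕ} (hn : 2 ≤ n) :
    HasSum (fun k => geomWeight n (k + 1) + ((k - 1 : ℕ) : ℝ) ^ n / 2 ^ k - 2 * geomWeight n k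
        + 4 / ((n : ℝ) - 1) * geomWeight n k) (4 / ((n : ℝ) - 1) * geomSum n) := by
  have h := hasSum_geomWeight n
  have h0 : geomWeight n 0 = 0 := by simp [geomWeight, show n ≠ 0 by lia]
  have h1 : HasSum (fun k => geomWeight n (k + 1)) (geomSum n) := by
    rw [hasSum_nat_add_iff]; simpa [h0] using h
  have h2 : HasSum (fun k : ℕ => ((k - 1 : ℕ) : ℝ) ^ n / 2 ^ k) (geomSum n) := by
    rw [← hasSum_nat_add_iff' 1]
    have h' : HasSum (fun k : ℕ => (k : ℝ) ^ n / 2 ^ (k + 1)) (geomSum n) := h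
    simpa [show n ≠ 0 by lia] using h'
  have h3 := ((h1.add h2).sub (h.mul_left 2)).add (h.mul_left (4 / ((n : ℝ) - 1)))
  rwa [← two_mul, sub_self, zero_add] at h3

lemma summable_geomWeight_mul_geomDeviation {n : ℕ} (hn : 2 ≤ n) :
    Summable fun k => geomWeight n k * geomDeviation n k :=
  Summable.of_nonneg_of_le
    (fun k => mul_nonneg (geomWeight_nonneg n k) (geomDeviation_nonneg n k))
    (geomWeight_mul_geomDeviation_le hn) (hasSum_geomWeight_bound hn).summable

lemma tsum_geomWeight_mul_geomDeviation_le {n : ℕ} (hn : 2 ≤ n) :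
    ∑' k, geomWeight n k * geomDeviation n k ≤ 4 / ((n : ℝ) - 1) * geomSum n := by
  rw [← (hasSum_geomWeight_bound hn).tsum_eq]
  exact (summable_geomWeight_mul_geomDeviation hn).tsum_le_tsum
    (geomWeight_mul_geomDeviation_le hn) (hasSum_geomWeight_bound hn).summable

lemma tendsto_div_of_geomDeviation {ι : Type*} {l : Filter ι} {n k : ι → ℕ}
    (hn : Tendsto n l atTop)
    (hD : Tendsto (fun x => geomDeviation (n x) (k x)) l (𝓝 0)) :
    Tendsto (fun x => (n x : ℝ) / k x) l (𝓝 (Real.log 2)) := by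
  have hlog2 : 0 < Real.log 2 := Real.log_pos (by norm_num)
  have hnR : Tendsto (fun x => (n x : ℝ)) l atTop := tendsto_natCast_atTop_atTop.comp hn
  have hninv : Tendsto (fun x => ((n x : ℝ))⁻¹) l (𝓝 0) := tendsto_inv_atTop_zero.comp hnR
  have hnpos : ∀ᶠ x in l, (0 : ℝ) < n x := hnR.eventually_gt_atTop 0
  have hX : Tendsto (fun x => (1 + (k x : ℝ)⁻¹) ^ n x) l (𝓝 2) := by
    have hb : Tendsto (fun x => geomDeviation (n x) (k x) +
        √(geomDeviation (n x) (k x) ^ 2 + 4 * geomDeviation (n x) (k x))) l (𝓝 0) := by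
      have := hD.add ((Real.continuous_sqrt.tendsto _).comp ((hD.pow 2).add (hD.const_mul 4)))
      simpa using this
    rw [tendsto_iff_dist_tendsto_zero]
    refine squeeze_zero (fun _ => dist_nonneg) (fun x => ?_) hb
    have hpos : 0 < (1 + (k x : ℝ)⁻¹) ^ n x := by positivity
    have hd0 := geomDeviation_nonneg (n x) (k x)
    have he : geomDeviation (n x) (k x) * (2 * (1 + (k x : ℝ)⁻¹) ^ n x) =
        ((1 + (k x : ℝ)⁻¹) ^ n x - 2) ^ 2 := by
      unfold geomDeviation; field_simp
    generalize (1 + (k x : ℝ)⁻¹) ^ n x = X at *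
    generalize geomDeviation (n x) (k x) = d at *
    have h1 : |X - 2 - d| ≤ √(d ^ 2 + 4 * d) := by
      apply Real.abs_le_sqrt
      nlinarith
    rw [Real.dist_eq]
    calc |X - 2| = |(X - 2 - d) + d| := by ring_nf
      _ ≤ |X - 2 - d| + |d| := abs_add_le _ _
      _ ≤ _ := by rw [abs_of_nonneg hd0]; linarith
  have hlog : Tendsto (fun x => n x * Real.log (1 + (k x : ℝ)⁻¹)) l (𝓝 (Real.log 2)) := by
    have := ((Real.continuousAt_log (by norm_num : (2 : ℝ) ≠ 0)).tendsto).comp hX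
    refine this.congr fun x => ?_
    simp [Real.log_pow]
  have hL : Tendsto (fun x => Real.log (1 + (k x : ℝ)⁻¹)) l (𝓝 0) := by
    have := hlog.mul hninv
    rw [mul_zero] at this
    refine this.congr' ?_
    filter_upwards [hnpos] with x hx
    field_simp
  have hu : Tendsto (fun x => 1 + (k x : ℝ)⁻¹) l (𝓝 1) := by
    have := (Real.continuous_exp.tendsto _).comp hL
    rw [Real.exp_zero] at this
    refine this.congr fun x => ?_
    simp only [Function.comp]
    rw [Real.exp_log (by positivity)]
  have hkpos : ∀ᶠ x in l, (0 : ℝ) < k x := by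
    filter_upwards [hlog.eventually (lt_mem_nhds hlog2)] with x hx
    rcases (Nat.cast_nonneg (k x) : (0 : ℝ) ≤ k x).eq_or_lt with h | h
    · rw [← h] at hx; simp at hx
    · exact h
  have hup := hlog.mul hu
  rw [mul_one] at hup
  refine tendsto_of_tendsto_of_tendsto_of_le_of_le' hlog hup ?_ ?_
  · filter_upwards [hnpos] with x hx
    have := Real.log_le_sub_one_of_pos (show 0 < 1 + (k x : ℝ)⁻¹ by positivity)
    rw [div_eq_mul_inv]
    gcongr
    linarith
  · filter_upwards [hnpos, hkpos] with x hx hx'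
    have hpos : 0 < 1 + (k x : ℝ)⁻¹ := by positivity
    have := Real.one_sub_inv_le_log_of_pos hpos
    rw [div_eq_mul_inv, mul_assoc]
    gcongr
    calc (k x : ℝ)⁻¹ = (1 - (1 + (k x : ℝ)⁻¹)⁻¹) * (1 + (k x : ℝ)⁻¹) := by
          rw [sub_mul, inv_mul_cancel₀ hpos.ne']; ring
      _ ≤ _ := by gcongr

/-- Squared relative deviation of `i` from `√n`. -/
noncomputable def fixedDeviation (n i : ℕ) : ℝ := ((i : ℝ) / √n - 1) ^ 2

lemma exists_abs_symRatio_sub_le {ε : ℝ} (hε : 0 < ε) :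
    ∃ δ > 0, ∃ N : ℕ, ∀ n ≥ N, ∀ k : ℕ, ∀ p ∈ involutionTypes n,
      |symRatio k p.1 p.2 - Real.exp (-(Real.log 2 + Real.log 2 ^ 2 / 4))| ≤
        ε + (geomDeviation n k + fixedDeviation n p.1) / δ := by
  set C := Real.exp (-(Real.log 2 + Real.log 2 ^ 2 / 4)) with hC
  let F : Filter (ℕ × ℕ × ℕ × ℕ) :=
    (comap (fun x => x.1) atTop ⊓
      comap (fun x => (geomDeviation x.1 x.2.1, fixedDeviation x.1 x.2.2.1)) (𝓝 (0, 0))) ⊓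
      𝓟 {x | x.2.2.1 + 2 * x.2.2.2 = x.1}
  have hn : Tendsto (fun x : ℕ × ℕ × ℕ × ℕ => x.1) F atTop :=
    tendsto_comap.mono_left (inf_le_left.trans inf_le_left)
  have hD : Tendsto (fun x : ℕ × ℕ × ℕ × ℕ =>
      (geomDeviation x.1 x.2.1, fixedDeviation x.1 x.2.2.1)) F (𝓝 (0, 0)) :=
    tendsto_comap.mono_left (inf_le_left.trans inf_le_right)
  have hi : Tendsto (fun x : ℕ × ℕ × ℕ × ℕ => (x.2.2.1 : ℝ) / √x.1) F (𝓝 1) := by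
    have h := (Real.continuous_sqrt.tendsto _).comp ((continuous_snd.tendsto _).comp hD)
    rw [Real.sqrt_zero] at h
    rw [tendsto_iff_dist_tendsto_zero]
    refine h.congr fun x => ?_
    simp [fixedDeviation, Real.sqrt_sq_eq_abs, Real.dist_eq]
  have hlim : Tendsto (fun x : ℕ × ℕ × ℕ × ℕ => symRatio x.2.1 x.2.2.1 x.2.2.2) F (𝓝 C) :=
    tendsto_symRatio (Real.log_pos (by norm_num)) hn
      (tendsto_div_of_geomDeviation hn ((continuous_fst.tendsto _).comp hD)) hi
      (mem_inf_of_right (mem_principal_self _))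
  have hev := hlim.eventually (Metric.closedBall_mem_nhds C hε)
  obtain ⟨b, hb⟩ : ∃ b : ℕ × ℝ, (0 < b.2) ∧ ∀ x : ℕ × ℕ × ℕ × ℕ, b.1 ≤ x.1 →
      dist (geomDeviation x.1 x.2.1, fixedDeviation x.1 x.2.2.1) (0, 0) < b.2 →
      x.2.2.1 + 2 * x.2.2.2 = x.1 → |symRatio x.2.1 x.2.2.1 x.2.2.2 - C| ≤ ε := by
    have hB := ((atTop_basis (α := ℕ)).comap (fun x : ℕ × ℕ × ℕ × ℕ => x.1)).inf
      ((Metric.nhds_basis_ball (x := ((0 : ℝ), (0 : ℝ)))).comap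
        (fun x : ℕ × ℕ × ℕ × ℕ => (geomDeviation x.1 x.2.1, fixedDeviation x.1 x.2.2.1)))
    obtain ⟨b, hb, h⟩ := (hB.inf_principal {x | x.2.2.1 + 2 * x.2.2.2 = x.1}).eventually_iff.1 hev
    exact ⟨b, hb.2, fun x h1 h2 h3 => h ⟨⟨h1, h2⟩, h3⟩⟩
  obtain ⟨hδ, h⟩ := hb
  refine ⟨b.2, hδ, b.1, fun n hn k p hp => ?_⟩
  have hg := geomDeviation_nonneg n k
  have hf : 0 ≤ fixedDeviation n p.1 := sq_nonneg _
  by_cases hlt : geomDeviation n k < b.2 ∧ fixedDeviation n p.1 < b.2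
  · have := h (n, k, p) hn (by
      rw [Prod.dist_eq, max_lt_iff, Real.dist_0_eq_abs, Real.dist_0_eq_abs, abs_of_nonneg hg,
        abs_of_nonneg hf]
      exact hlt) (mem_involutionTypes.1 hp)
    have h0 : 0 ≤ (geomDeviation n k + fixedDeviation n p.1) / b.2 := by positivity
    linarith
  · have h1 : |symRatio k p.1 p.2 - C| ≤ 1 := by
      have := symRatio_nonneg k p.1 p.2
      have := symRatio_le_one k p.1 p.2
      have hC0 : 0 < C := Real.exp_pos _
      have hC1 : C ≤ 1 := by
        rw [hC, Real.exp_le_one_iff]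
        have : 0 < Real.log 2 := Real.log_pos (by norm_num)
        nlinarith [sq_nonneg (Real.log 2)]
      rw [abs_le]; constructor <;> linarith
    have h2 : 1 ≤ (geomDeviation n k + fixedDeviation n p.1) / b.2 := by
      rw [one_le_div hδ]
      by_contra! hcon
      exact hlt ⟨by linarith, by linarith⟩
    linarith

/-- Average of `symRatio k` over involution types, scaled by `involutionSum n`. -/
noncomputable def symAverage (n k : ℕ) : ℝ :=
  ∑ p ∈ involutionTypes n, involutionWeight p * symRatio k p.1 p.2

lemma symAverage_nonneg (n k : ℕ) : 0 ≤ symAverage n k :=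
  Finset.sum_nonneg fun p _ => mul_nonneg (involutionWeight_pos p).le (symRatio_nonneg _ _ _)

lemma symAverage_le (n k : ℕ) : symAverage n k ≤ involutionSum n :=
  Finset.sum_le_sum fun p _ =>
    mul_le_of_le_one_right (involutionWeight_pos p).le (symRatio_le_one _ _ _)

lemma summable_geomWeight_mul_symAverage (n : ℕ) :
    Summable fun k => geomWeight n k * symAverage n k :=
  Summable.of_nonneg_of_le (fun k => mul_nonneg (geomWeight_nonneg n k) (symAverage_nonneg n k))
    (fun k => mul_le_mul_of_nonneg_left (symAverage_le n k) (geomWeight_nonneg n k))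
    ((summable_geomWeight n).mul_right (involutionSum n))

lemma abs_symAverage_sub_le {n k : ℕ} {C ε δ : ℝ} (hn : 2 ≤ n) (hδ : 0 < δ)
    (h : ∀ p ∈ involutionTypes n, |symRatio k p.1 p.2 - C| ≤
        ε + (geomDeviation n k + fixedDeviation n p.1) / δ) :
    |symAverage n k - C * involutionSum n| ≤
      involutionSum n * (ε + 2 / √n / δ) + involutionSum n / δ * geomDeviation n k := by
  have he : symAverage n k - C * involutionSum n =
      ∑ p ∈ involutionTypes n, involutionWeight p * (symRatio k p.1 p.2 - C) := by
    rw [symAverage, involutionSum, Finset.mul_sum, ← Finset.sum_sub_distrib]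
    exact Finset.sum_congr rfl fun p _ => by ring
  rw [he]
  calc _ ≤ ∑ p ∈ involutionTypes n, |involutionWeight p * (symRatio k p.1 p.2 - C)| :=
        Finset.abs_sum_le_sum_abs _ _
    _ ≤ ∑ p ∈ involutionTypes n, (involutionWeight p * (ε + geomDeviation n k / δ) +
          fixedDeviation n p.1 * involutionWeight p / δ) := by
        refine Finset.sum_le_sum fun p hp => ?_
        have hw := involutionWeight_pos p
        rw [abs_mul, abs_of_pos hw]
        refine (mul_le_mul_of_nonneg_left (h p hp) hw.le).trans (le_of_eq ?_)
        ring
    _ = involutionSum n * (ε + geomDeviation n k / δ) +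
          (∑ p ∈ involutionTypes n, fixedDeviation n p.1 * involutionWeight p) / δ := by
        rw [Finset.sum_add_distrib, ← Finset.sum_mul, ← Finset.sum_div, involutionSum]
    _ ≤ involutionSum n * (ε + geomDeviation n k / δ) + 2 / √n * involutionSum n / δ := by
        gcongr
        exact sum_sq_sub_one_mul_involutionWeight_le hn
    _ = _ := by ring

lemma abs_tsum_symAverage_sub_le {n : ℕ} {C ε δ : ℝ} (hn : 2 ≤ n) (hδ : 0 < δ)
    (h : ∀ k : ℕ, ∀ p ∈ involutionTypes n, |symRatio k p.1 p.2 - C| ≤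
        ε + (geomDeviation n k + fixedDeviation n p.1) / δ) :
    |(∑' k, geomWeight n k * symAverage n k) / (involutionSum n * geomSum n) - C| ≤
      ε + (2 / √n + 4 / ((n : ℝ) - 1)) / δ := by
  have hI := involutionSum_pos n
  have hG := geomSum_pos n
  have h1 : HasSum (fun k => geomWeight n k * (symAverage n k - C * involutionSum n))
      ((∑' k, geomWeight n k * symAverage n k) - geomSum n * (C * involutionSum n)) := by
    have := (summable_geomWeight_mul_symAverage n).hasSum.sub
      ((hasSum_geomWeight n).mul_right (C * involutionSum n))
    simpa only [mul_sub] using this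
  have h2 : HasSum (fun k => geomWeight n k * (involutionSum n * (ε + 2 / √n / δ)) +
      involutionSum n / δ * (geomWeight n k * geomDeviation n k))
      (geomSum n * (involutionSum n * (ε + 2 / √n / δ)) +
        involutionSum n / δ * ∑' k, geomWeight n k * geomDeviation n k) :=
    ((hasSum_geomWeight n).mul_right _).add
      ((summable_geomWeight_mul_geomDeviation hn).hasSum.mul_left _)
  have h3 := tsum_of_norm_bounded h2 (f := fun k => geomWeight n k *
      (symAverage n k - C * involutionSum n)) fun k => by
    have hg := geomWeight_nonneg n k
    rw [Real.norm_eq_abs, abs_mul, abs_of_nonneg hg]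
    refine (mul_le_mul_of_nonneg_left (abs_symAverage_sub_le hn hδ (h k)) hg).trans (le_of_eq ?_)
    ring
  rw [h1.tsum_eq, Real.norm_eq_abs] at h3
  have hIG : 0 < involutionSum n * geomSum n := by positivity
  have h4 : (∑' k, geomWeight n k * symAverage n k) / (involutionSum n * geomSum n) - C =
      ((∑' k, geomWeight n k * symAverage n k) - geomSum n * (C * involutionSum n)) /
        (involutionSum n * geomSum n) := by
    field_simp
  rw [h4, abs_div, abs_of_pos hIG, div_le_iff₀ hIG]
  refine h3.trans ?_
  calc _ ≤ geomSum n * (involutionSum n * (ε + 2 / √n / δ)) +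
        involutionSum n / δ * (4 / ((n : ℝ) - 1) * geomSum n) := by
        gcongr
        exact tsum_geomWeight_mul_geomDeviation_le hn
    _ = _ := by ring

lemma tendsto_tsum_symAverage :
    Tendsto (fun n => (∑' k, geomWeight n k * symAverage n k) / (involutionSum n * geomSum n))
      atTop (𝓝 (Real.exp (-(Real.log 2 + Real.log 2 ^ 2 / 4)))) := by
  rw [Metric.tendsto_nhds]
  intro ε hε
  obtain ⟨δ, hδ, N, h⟩ := exists_abs_symRatio_sub_le (half_pos hε)
  have hn : Tendsto (fun n : ℕ => (n : ℝ)) atTop atTop := tendsto_natCast_atTop_atTop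
  have hlim : Tendsto (fun n : ℕ => ε / 2 + (2 / √n + 4 / ((n : ℝ) - 1)) / δ) atTop
      (𝓝 (ε / 2)) := by
    have h1 := (Real.tendsto_sqrt_atTop.comp hn).const_div_atTop 2
    have h2 := (tendsto_atTop_add_const_right atTop (-1) hn).const_div_atTop 4
    simpa [sub_eq_add_neg] using ((h1.add h2).div_const δ).const_add (ε / 2)
  filter_upwards [hlim.eventually (gt_mem_nhds (half_lt_self hε)), eventually_ge_atTop N,
    eventually_ge_atTop 2] with n h1 h2 h3
  rw [Real.dist_eq]
  exact (abs_tsum_symAverage_sub_le h3 hδ (h n h2)).trans_lt h1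

lemma card_cycleType_replicate_two {n : ℕ} {p : ℕ × ℕ} (hp : p ∈ involutionTypes n) :
    ((Finset.univ.filter fun σ : Equiv.Perm (Fin n) =>
      σ.cycleType = Multiset.replicate p.2 2).card : ℝ) = n.factorial * involutionWeight p := by
  have hp := mem_involutionTypes.1 hp
  have hw : involutionWeight p = (((p.1.factorial * 2 ^ p.2 * p.2.factorial : ℕ)) : ℝ)⁻¹ := by
    unfold involutionWeight; push_cast; ring
  have hprod : ∏ m ∈ (Multiset.replicate p.2 2).toFinset,
      ((Multiset.replicate p.2 2).count m).factorial = p.2.factorial := by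
    rcases Nat.eq_zero_or_pos p.2 with h | h
    · simp [h]
    · rw [Multiset.toFinset_replicate, if_neg h.ne']; simp
  have hcount := Equiv.Perm.card_of_cycleType_mul_eq (Fin n) (Multiset.replicate p.2 2)
  rw [if_pos (by
    refine ⟨by simp; lia, fun a ha => (Multiset.eq_of_mem_replicate ha).ge⟩), hprod] at hcount
  simp only [Fintype.card_fin, Multiset.sum_replicate, Multiset.prod_replicate, smul_eq_mul,
    show n - p.2 * 2 = p.1 by lia] at hcount
  rw [hw, eq_mul_inv_iff_mul_eq₀ (by positivity)]
  exact_mod_cast hcount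

lemma numInvolutions_eq (n : ℕ) :
    (numInvolutions n : ℝ) = n.factorial * involutionSum n := by
  have h2 : ∀ σ : Equiv.Perm (Fin n), σ * σ = 1 ↔
      σ.cycleType = Multiset.replicate (Multiset.card σ.cycleType) 2 := fun σ => by
    rw [← sq, Equiv.Perm.pow_prime_eq_one_iff, Multiset.eq_replicate]
    simp
  have hcard : numInvolutions n =
      (Finset.univ.filter fun σ : Equiv.Perm (Fin n) => σ * σ = 1).card := by
    rw [numInvolutions, Nat.card_eq_fintype_card, Fintype.card_subtype]
  rw [hcard, Finset.card_eq_sum_card_fiberwise (t := involutionTypes n)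
    (f := fun σ => (n - 2 * Multiset.card σ.cycleType, Multiset.card σ.cycleType))]
  · rw [involutionSum, Finset.mul_sum, Nat.cast_sum]
    refine Finset.sum_congr rfl fun p hp => ?_
    rw [← card_cycleType_replicate_two hp, Finset.filter_filter]
    congr 2
    ext σ
    simp only [Finset.mem_filter, Finset.mem_univ, true_and]
    constructor
    · rintro ⟨h, rfl⟩
      exact (h2 σ).1 h
    · intro h
      have hc : Multiset.card σ.cycleType = p.2 := by rw [h, Multiset.card_replicate]
      refine ⟨(h2 σ).2 (by rw [hc]; exact h), ?_⟩
      have := mem_involutionTypes.1 hp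
      ext <;> simp only [hc]
      lia
  · intro σ hσ
    simp only [Finset.coe_filter, Finset.mem_univ, true_and, Set.mem_ofPred_eq] at hσ
    have hsum : σ.cycleType.sum ≤ n := by
      rw [Equiv.Perm.sum_cycleType]
      simpa using Finset.card_le_univ σ.support
    rw [(h2 σ).1 hσ, Multiset.sum_replicate, smul_eq_mul] at hsum
    simp only [Finset.mem_coe, mem_involutionTypes]
    lia

lemma hasSum_choose_div_two_pow (i : ℕ) :
    HasSum (fun k : ℕ => (k.choose i : ℝ) / 2 ^ (k + 1)) 1 := by
  have h := (hasSum_choose_mul_geometric_of_norm_lt_one (𝕜 := ℝ) i (r := 1 / 2)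
    (by norm_num)).mul_right (1 / 2 ^ (i + 1))
  rw [← hasSum_nat_add_iff' i, Finset.sum_eq_zero, sub_zero]
  · have hf : (fun m : ℕ => ((m + i).choose i : ℝ) / 2 ^ (m + i + 1)) =
        fun m => ((m + i).choose i : ℝ) * (1 / 2) ^ m * (1 / 2 ^ (i + 1)) := by
      ext m
      rw [one_div_pow]
      field_simp
      ring
    have h1 : (1 : ℝ) / (1 - 1 / 2) ^ (i + 1) * (1 / 2 ^ (i + 1)) = 1 := by
      rw [show (1 : ℝ) - 1 / 2 = 1 / 2 by norm_num, one_div_pow]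
      field_simp
    rw [h1] at h
    rw [hf]
    exact h
  · intro k hk
    rw [Nat.choose_eq_zero_of_lt (Finset.mem_range.1 hk)]
    simp

/-- Inverting a binomial transform by summing against `2 ^ (-k - 1)`. -/
lemma hasSum_div_two_pow_of_binomial {a b : ℕ → ℕ} {n : ℕ}
    (hab : ∀ k, a k = ∑ i ∈ Finset.range (k + 1), k.choose i * b i) (hb : ∀ i, n < i → b i = 0) :
    HasSum (fun k => (a k : ℝ) / 2 ^ (k + 1)) (∑ i ∈ Finset.range (n + 1), (b i : ℝ)) := by
  have hab' : ∀ k, a k = ∑ i ∈ Finset.range (n + 1), k.choose i * b i := fun k => by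
    rw [hab]
    rcases le_total k n with h | h
    · refine Finset.sum_subset (Finset.range_mono (by lia)) fun i _ hi => ?_
      rw [Nat.choose_eq_zero_of_lt (by simpa using hi), zero_mul]
    · refine (Finset.sum_subset (Finset.range_mono (by lia)) fun i _ hi => ?_).symm
      rw [hb i (by simpa using hi), mul_zero]
  have := hasSum_sum (s := Finset.range (n + 1)) fun i _ =>
    (hasSum_choose_div_two_pow i).mul_right (b i : ℝ)
  simp only [one_mul] at this
  have hf : (fun k => (a k : ℝ) / 2 ^ (k + 1)) = fun k =>
      ∑ i ∈ Finset.range (n + 1), (k.choose i : ℝ) / 2 ^ (k + 1) * (b i : ℝ) := by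
    ext k
    rw [hab', Nat.cast_sum, Finset.sum_div]
    refine Finset.sum_congr rfl fun i _ => ?_
    push_cast; ring
  rw [hf]
  exact this

lemma nat_card_eq_sum_fiber {α β : Type*} [Finite α] [Fintype β] (f : α → β) :
    Nat.card α = ∑ b, Nat.card {x // f x = b} := by
  rw [← Nat.card_congr (Equiv.sigmaFiberEquiv f), Nat.card_sigma]

/-- The number of surjections from an `n`-set to an `i`-set. -/
noncomputable def surjCount (n i : ℕ) : ℕ :=
  Nat.card {f : Fin n → Fin i // Function.Surjective f}

lemma surjCount_eq_zero {n i : ℕ} (h : n < i) : surjCount n i = 0 := by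
  rw [surjCount, Nat.card_eq_zero]
  refine Or.inl ⟨fun f => ?_⟩
  have := Fintype.card_le_of_surjective f.1 f.2
  simp at this
  lia

lemma card_range_eq (n k : ℕ) (s : Finset (Fin k)) :
    Nat.card {f : Fin n → Fin k // Finset.univ.image f = s} = surjCount n s.card := by
  have hmem : ∀ f : {f : Fin n → Fin k // Finset.univ.image f = s}, ∀ x, f.1 x ∈ s := fun f x => by
    have := Finset.mem_image_of_mem f.1 (Finset.mem_univ x)
    rwa [f.2] at this
  refine Nat.card_congr
    { toFun := fun f => ⟨fun x => s.equivFin ⟨f.1 x, hmem f x⟩, fun y => ?_⟩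
      invFun := fun g => ⟨fun x => (s.equivFin.symm (g.1 x)).1, ?_⟩
      left_inv := fun f => by simp
      right_inv := fun g => by simp }
  · have h1 := (s.equivFin.symm y).2
    obtain ⟨x, _, hx⟩ := Finset.mem_image.1 (by rw [f.2]; exact h1 :
      (s.equivFin.symm y).1 ∈ Finset.univ.image f.1)
    exact ⟨x, by simp [hx]⟩
  · ext a
    simp only [Finset.mem_image, Finset.mem_univ, true_and]
    constructor
    · rintro ⟨x, rfl⟩
      exact (s.equivFin.symm (g.1 x)).2
    · intro ha
      obtain ⟨x, hx⟩ := g.2 (s.equivFin ⟨a, ha⟩)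
      exact ⟨x, by simp [hx]⟩

lemma sum_finset_card (k : ℕ) (b : ℕ → ℕ) :
    ∑ s : Finset (Fin k), b s.card = ∑ i ∈ Finset.range (k + 1), k.choose i * b i := by
  have := Finset.sum_powerset_apply_card b (x := (Finset.univ : Finset (Fin k)))
  simpa using this

lemma pow_eq_sum_choose_mul_surjCount (n k : ℕ) :
    k ^ n = ∑ i ∈ Finset.range (k + 1), k.choose i * surjCount n i := by
  rw [← sum_finset_card, ← Finset.sum_congr rfl fun s _ => card_range_eq n k s,
    ← nat_card_eq_sum_fiber (fun f : Fin n → Fin k => Finset.univ.image f)]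
  simp

/-- The total preorder pulled back along a map to a finite chain. -/
def pullbackLE {n i : ℕ} (f : Fin n → Fin i) (x y : Fin n) : Prop := f x ≤ f y

lemma eq_of_pullbackLE_eq {n i i' : ℕ} {f : Fin n → Fin i} {g : Fin n → Fin i'}
    (hf : Function.Surjective f) (hg : Function.Surjective g)
    (h : pullbackLE f = pullbackLE g) : i = i' ∧ ∀ x, (f x : ℕ) = g x := by
  have hle : ∀ x y, f x ≤ f y ↔ g x ≤ g y := fun x y => (congrFun (congrFun h x) y).to_iff
  let φ : Fin i → Fin i' := fun a => g (Function.surjInv hf a)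
  have hφ : ∀ x, φ (f x) = g x := fun x => by
    have := Function.surjInv_eq hf (f x)
    exact le_antisymm ((hle _ _).1 this.le) ((hle _ _).1 this.ge)
  have hφle : ∀ a b, φ a ≤ φ b ↔ a ≤ b := fun a b => by
    obtain ⟨x, rfl⟩ := hf a
    obtain ⟨y, rfl⟩ := hf b
    rw [hφ, hφ, hle]
  have hsurj : Function.Surjective φ := fun b => by
    obtain ⟨x, rfl⟩ := hg b
    exact ⟨f x, hφ x⟩
  have hinj : Function.Injective φ := fun a b hab =>
    le_antisymm ((hφle a b).1 hab.le) ((hφle b a).1 hab.ge)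
  have hi : i = i' := by simpa using Fintype.card_of_bijective ⟨hinj, hsurj⟩
  subst hi
  refine ⟨rfl, fun x => ?_⟩
  let e : Fin i ≃o Fin i := ⟨Equiv.ofBijective φ ⟨hinj, hsurj⟩, fun {a b} => hφle a b⟩
  have he : e = OrderIso.refl _ := Subsingleton.elim _ _
  rw [← hφ x]
  exact congrArg Fin.val (DFunLike.congr_fun he (f x)).symm

lemma exists_surjective_le_iff {α : Type*} [Fintype α] [Preorder α]
    (htot : ∀ a b : α, a ≤ b ∨ b ≤ a) :
    ∃ i ≤ Fintype.card α, ∃ f : α → Fin i, Function.Surjective f ∧ ∀ x y, f x ≤ f y ↔ x ≤ y := by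
  classical
  have : @Std.Total α (· ≤ ·) := ⟨htot⟩
  let Q := Antisymmetrization α (· ≤ ·)
  have hq : Function.Surjective (toAntisymmetrization (α := α) (· ≤ ·)) := Quotient.mk_surjective
  let _ : Fintype Q := Fintype.ofSurjective _ hq
  let e : Fin (Fintype.card Q) ≃o Q := Fintype.orderIsoFinOfCardEq Q rfl
  refine ⟨Fintype.card Q, Fintype.card_le_of_surjective _ hq,
    fun x => e.symm (toAntisymmetrization (· ≤ ·) x), e.symm.surjective.comp hq, fun x y => ?_⟩
  rw [e.symm.le_iff_le]
  exact toAntisymmetrization_le_toAntisymmetrization_iff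

lemma numPreorders_eq_sum (n : ℕ) :
    numPreorders n = ∑ i ∈ Finset.range (n + 1), surjCount n i := by
  rw [Finset.sum_range]
  unfold surjCount
  rw [← Nat.card_sigma, numPreorders]
  symm
  refine Nat.card_eq_of_bijective (fun x : Σ i : Fin (n + 1),
      {f : Fin n → Fin i // Function.Surjective f} =>
    (⟨pullbackLE x.2.1, fun a => le_refl (x.2.1 a), fun a b c hab hbc => le_trans hab hbc,
      fun a b => (le_total (x.2.1 a) (x.2.1 b)).imp_right Or.inr⟩ :
      {R : Fin n → Fin n → Prop //
        (∀ x, R x x) ∧ (∀ x y z, R x y → R y z → R x z) ∧ (∀ x y, R x y ∨ x = y ∨ R y x)})) ⟨?_, ?_⟩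
  · rintro ⟨⟨i, hi⟩, f, hf⟩ ⟨⟨i', hi'⟩, g, hg⟩ h
    obtain ⟨h1, h2⟩ := eq_of_pullbackLE_eq hf hg (Subtype.ext_iff.1 h)
    dsimp only at h1 f g
    subst h1
    have : f = g := funext fun x => Fin.ext (h2 x)
    subst this
    rfl
  · rintro ⟨R, hrefl, htrans, htri⟩
    obtain ⟨i, hi, f, hf, h⟩ := @exists_surjective_le_iff (Fin n) _
      { le := R
        lt := fun a b => R a b ∧ ¬ R b a
        le_refl := hrefl
        le_trans := htrans } (fun a b => by
      rcases htri a b with h | rfl | h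
      exacts [Or.inl h, Or.inl (hrefl a), Or.inr h])
    refine ⟨⟨⟨i, by simpa [Nat.lt_succ_iff] using hi⟩, f, hf⟩, Subtype.ext ?_⟩
    funext x y
    exact propext (h x y)

lemma numPreorders_eq_geomSum (n : ℕ) : (numPreorders n : ℝ) = geomSum n := by
  have h := hasSum_div_two_pow_of_binomial (pow_eq_sum_choose_mul_surjCount n)
    fun i hi => surjCount_eq_zero hi
  rw [numPreorders_eq_sum, Nat.cast_sum, ← h.tsum_eq, geomSum]
  simp [geomWeight]

lemma le_numOnes_of_isIncidence {k l : ℕ} {M : Matrix (Fin k) (Fin l) Bool}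
    (hM : IsIncidence M) : k ≤ numOnes M := by
  choose f hf using hM.1
  have := Finset.card_le_card_of_injOn (s := (Finset.univ : Finset (Fin k)))
    (t := Finset.univ.filter fun p : Fin k × Fin l => M p.1 p.2 = true) (fun i => (i, f i))
    (fun i _ => by simp [hf]) (fun a _ b _ h => (Prod.ext_iff.1 h).1)
  simpa [numOnes] using this

lemma muSym_eq_zero {i n : ℕ} (h : n < i) : muSym i n = 0 := by
  rw [muSym, Nat.card_eq_zero]
  refine Or.inl ⟨fun M => ?_⟩
  have := le_numOnes_of_isIncidence M.2.2.1
  rw [M.2.2.2] at this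
  lia

lemma S11_eq_sum_muSym (n : ℕ) : S11 n = ∑ i ∈ Finset.range (n + 1), muSym i n := by
  rw [Finset.sum_range]
  unfold muSym
  rw [← Nat.card_sigma, S11]
  exact Nat.card_congr
    { toFun := fun A => ⟨⟨A.1.1, by
          have := le_numOnes_of_isIncidence A.2.2.1
          rw [A.2.2.2] at this
          lia⟩, ⟨A.1.2, A.2⟩⟩
      invFun := fun x => ⟨⟨x.1, x.2.1⟩, x.2.2⟩
      left_inv := fun _ => rfl
      right_inv := fun _ => rfl }

/-- The set of indices of nonzero rows. -/
noncomputable def rowSupport {k : ℕ} (M : Matrix (Fin k) (Fin k) Bool) : Finset (Fin k) := by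
  classical exact Finset.univ.filter fun a => ∃ b, M a b = true

lemma mem_rowSupport {k : ℕ} {M : Matrix (Fin k) (Fin k) Bool} {a : Fin k} :
    a ∈ rowSupport M ↔ ∃ b, M a b = true := by
  simp [rowSupport]

lemma numOnes_submatrix {k m : ℕ} {M : Matrix (Fin k) (Fin k) Bool}
    (hM : ∀ a b, M a b = M b a) (e : Fin m ≃ rowSupport M) :
    numOnes (M.submatrix (fun x => (e x).1) fun x => (e x).1) = numOnes M := by
  unfold numOnes
  refine Finset.card_bij (fun p _ => ((e p.1).1, (e p.2).1)) ?_ ?_ ?_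
  · intro p hp
    exact Finset.mem_filter.2 ⟨Finset.mem_univ _, (Finset.mem_filter.1 hp).2⟩
  · rintro ⟨a, b⟩ _ ⟨c, d⟩ _ h
    simpa [Subtype.ext_iff.symm] using h
  · rintro ⟨a, b⟩ hp
    simp only [Finset.mem_filter, Finset.mem_univ, true_and] at hp
    have ha : a ∈ rowSupport M := mem_rowSupport.2 ⟨b, hp⟩
    have hb : b ∈ rowSupport M := mem_rowSupport.2 ⟨a, by rw [hM]; exact hp⟩
    exact ⟨(e.symm ⟨a, ha⟩, e.symm ⟨b, hb⟩), Finset.mem_filter.2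
      ⟨Finset.mem_univ _, by simpa using hp⟩, by simp⟩

lemma card_rowSupport_eq (k n : ℕ) (s : Finset (Fin k)) :
    Nat.card {M : {M : Matrix (Fin k) (Fin k) Bool // (∀ a b, M a b = M b a) ∧ numOnes M = n} //
      rowSupport M.1 = s} = muSym s.card n := by
  classical
  let e : Fin s.card ≃ s := s.equivFin.symm
  have hsub : ∀ M : Matrix (Fin k) (Fin k) Bool, (∀ a b, M a b = M b a) → rowSupport M = s →
      IsIncidence (M.submatrix (fun x => (e x).1) fun x => (e x).1) ∧
      numOnes (M.submatrix (fun x => (e x).1) fun x => (e x).1) = numOnes M := by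
    rintro M hM rfl
    have hrow : ∀ i, ∃ j, M (e i).1 (e j).1 = true := fun i => by
      obtain ⟨b, hb⟩ := mem_rowSupport.1 (e i).2
      exact ⟨e.symm ⟨b, mem_rowSupport.2 ⟨_, by rw [hM]; exact hb⟩⟩, by simpa using hb⟩
    refine ⟨⟨hrow, fun j => ?_⟩, numOnes_submatrix hM e⟩
    obtain ⟨i, hi⟩ := hrow j
    exact ⟨i, by rw [Matrix.submatrix_apply, hM]; exact hi⟩
  refine Nat.card_eq_of_bijective (fun M => ⟨M.1.1.submatrix (fun x => (e x).1) fun x => (e x).1,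
    fun a b => M.1.2.1 _ _, (hsub _ M.1.2.1 M.2).1,
    (hsub _ M.1.2.1 M.2).2.trans M.1.2.2⟩) ⟨?_, ?_⟩
  · rintro ⟨⟨M, hM, hMn⟩, hMs⟩ ⟨⟨M', hM', hMn'⟩, hMs'⟩ h
    refine Subtype.ext (Subtype.ext ?_)
    have h' := Subtype.ext_iff.1 h
    dsimp only at h' hMs hMs' ⊢
    have hout : ∀ A : Matrix (Fin k) (Fin k) Bool, (∀ a b, A a b = A b a) → rowSupport A = s →
        ∀ a b, ¬ (a ∈ s ∧ b ∈ s) → A a b = false := by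
      rintro A hA rfl a b hab
      by_contra hcon
      rw [Bool.not_eq_false] at hcon
      exact hab ⟨mem_rowSupport.2 ⟨b, hcon⟩, mem_rowSupport.2 ⟨a, by rw [hA]; exact hcon⟩⟩
    ext a b
    by_cases hab : a ∈ s ∧ b ∈ s
    · have := congrFun (congrFun h' (e.symm ⟨a, hab.1⟩)) (e.symm ⟨b, hab.2⟩)
      simp only [Matrix.submatrix_apply, Equiv.apply_symm_apply] at this
      rw [this]
    · rw [hout M hM hMs a b hab, hout M' hM' hMs' a b hab]
  · rintro ⟨A, hA, hAi, hAn⟩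
    let M : Matrix (Fin k) (Fin k) Bool := fun a b =>
      if h : a ∈ s ∧ b ∈ s then A (e.symm ⟨a, h.1⟩) (e.symm ⟨b, h.2⟩) else false
    have hM : ∀ a b, M a b = M b a := fun a b => by
      by_cases h : a ∈ s ∧ b ∈ s
      · simp only [M, dif_pos h, dif_pos h.symm, hA (e.symm ⟨a, h.1⟩)]
      · simp only [M, dif_neg h, dif_neg (fun h' => h (And.symm h'))]
    have hMA : M.submatrix (fun x => (e x).1) (fun x => (e x).1) = A := by
      ext i j
      have h : (e i).1 ∈ s ∧ (e j).1 ∈ s := ⟨(e i).2, (e j).2⟩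
      rw [Matrix.submatrix_apply]
      exact (dif_pos h).trans (by simp)
    have hMs : rowSupport M = s := by
      ext a
      rw [mem_rowSupport]
      constructor
      · rintro ⟨b, hb⟩
        by_contra ha
        simp [M, ha] at hb
      · intro ha
        obtain ⟨j, hj⟩ := hAi.1 (e.symm ⟨a, ha⟩)
        refine ⟨(e j).1, ?_⟩
        have h : a ∈ s ∧ (e j).1 ∈ s := ⟨ha, (e j).2⟩
        simpa only [M, dif_pos h, Subtype.coe_eta, Equiv.symm_apply_apply] using hj
    have hMn : numOnes M = n := by rw [← (hsub M hM hMs).2, hMA, hAn]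
    exact ⟨⟨⟨M, hM, hMn⟩, hMs⟩, Subtype.ext hMA⟩

lemma sSym_eq_sum_choose_mul_muSym (k n : ℕ) :
    sSym k n = ∑ i ∈ Finset.range (k + 1), k.choose i * muSym i n := by
  rw [← sum_finset_card k fun i => muSym i n,
    ← Finset.sum_congr rfl fun s _ => card_rowSupport_eq k n s, ← nat_card_eq_sum_fiber, sSym]

lemma hasSum_sSym (n : ℕ) : HasSum (fun k => (sSym k n : ℝ) / 2 ^ (k + 1)) (S11 n) := by
  rw [S11_eq_sum_muSym, Nat.cast_sum]
  exact hasSum_div_two_pow_of_binomial (fun k => sSym_eq_sum_choose_mul_muSym k n)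
    fun i hi => muSym_eq_zero hi

/-- The positions strictly above the diagonal. -/
def strictUpper (k : ℕ) : Finset (Fin k × Fin k) := Finset.univ.filter fun p => p.1 < p.2

lemma mem_strictUpper {k : ℕ} {p : Fin k × Fin k} : p ∈ strictUpper k ↔ p.1 < p.2 := by
  simp [strictUpper]

lemma card_strictUpper (k : ℕ) : (strictUpper k).card = k.choose 2 := by
  rw [strictUpper, Finset.card_filter, Fintype.sum_prod_type_right]
  simp only [← Finset.card_filter]
  have h : ∀ b : Fin k, (Finset.univ.filter fun a : Fin k => a < b).card = b := fun b => by
    rw [← Fin.card_Iio b]; congr 1; ext a; simp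
  simp only [h]
  rw [← Finset.sum_range (fun i => i), Finset.sum_range_id, Nat.choose_two_right]

lemma numOnes_eq_of_symmetric {k : ℕ} {M : Matrix (Fin k) (Fin k) Bool}
    (hM : ∀ a b, M a b = M b a) :
    numOnes M = (Finset.univ.filter fun a => M a a = true).card +
      2 * ((strictUpper k).filter fun p => M p.1 p.2 = true).card := by
  have h1 : (Finset.univ.filter fun p : Fin k × Fin k => M p.1 p.2 = true ∧ p.1 = p.2).card =
      (Finset.univ.filter fun a => M a a = true).card := by
    symm
    refine Finset.card_bij (fun a _ => (a, a)) (by simp) (by simp) ?_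
    rintro ⟨a, b⟩ h
    simp only [Finset.mem_filter, Finset.mem_univ, true_and] at h
    obtain ⟨h, rfl⟩ := h
    exact ⟨a, by simpa using h, rfl⟩
  have h2 : (Finset.univ.filter fun p : Fin k × Fin k => M p.1 p.2 = true ∧ p.1 < p.2).card =
      ((strictUpper k).filter fun p => M p.1 p.2 = true).card := by
    congr 1; ext p; simp [mem_strictUpper, and_comm]
  have h3 : (Finset.univ.filter fun p : Fin k × Fin k => M p.1 p.2 = true ∧ p.2 < p.1).card =
      ((strictUpper k).filter fun p => M p.1 p.2 = true).card := by
    refine Finset.card_bij (fun p _ => (p.2, p.1)) ?_ ?_ ?_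
    · rintro ⟨a, b⟩ h
      simp only [Finset.mem_filter, Finset.mem_univ, true_and, mem_strictUpper] at h ⊢
      exact ⟨h.2, by rw [hM]; exact h.1⟩
    · rintro ⟨a, b⟩ _ ⟨c, d⟩ _ h
      simp only [Prod.mk.injEq] at h ⊢
      exact h.symm
    · rintro ⟨a, b⟩ h
      simp only [Finset.mem_filter, mem_strictUpper] at h
      exact ⟨(b, a), by simp [h.1, hM b a, h.2], rfl⟩
  rw [← h1, two_mul]
  nth_rewrite 1 [← h2]
  rw [← h3, numOnes]
  simp only [Finset.card_filter, ← Finset.sum_add_distrib]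
  refine Finset.sum_congr rfl fun p _ => ?_
  rcases lt_trichotomy p.1 p.2 with h | h | h
  · simp [h, h.ne, h.not_gt]
  · simp [h]
  · simp [h, h.ne', h.not_gt]

lemma sSym_eq_sum_involutionTypes (k n : ℕ) :
    sSym k n = ∑ p ∈ involutionTypes n, k.choose p.1 * (k.choose 2).choose p.2 := by
  classical
  let T := ((Finset.univ : Finset (Finset (Fin k))) ×ˢ (strictUpper k).powerset).filter
    fun q => q.1.card + 2 * q.2.card = n
  let ofParts : Finset (Fin k) × Finset (Fin k × Fin k) → Matrix (Fin k) (Fin k) Bool :=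
    fun q a b => decide ((a = b ∧ a ∈ q.1) ∨ (a, b) ∈ q.2 ∨ (b, a) ∈ q.2)
  have hsymm : ∀ q a b, ofParts q a b = ofParts q b a := fun q a b => by
    simp only [ofParts, decide_eq_decide]
    grind
  have hparts : ∀ q ∈ T, (Finset.univ.filter fun a => ofParts q a a = true,
      (strictUpper k).filter fun p => ofParts q p.1 p.2 = true) = q := by
    intro q hq
    simp only [T, Finset.mem_filter, Finset.mem_product, Finset.mem_univ, true_and,
        Finset.mem_powerset] at hq
    have hlt : ∀ a b, (a, b) ∈ q.2 → a < b := fun a b h => mem_strictUpper.1 (hq.1 h)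
    refine Prod.ext ?_ ?_
    · ext a
      simp only [Finset.mem_filter, Finset.mem_univ, true_and, ofParts, decide_eq_true_eq]
      grind
    · ext ⟨a, b⟩
      simp only [Finset.mem_filter, mem_strictUpper, ofParts, decide_eq_true_eq]
      grind
  have hcard : sSym k n = T.card := by
    rw [sSym, Nat.card_eq_fintype_card, Fintype.card_subtype]
    refine Finset.card_bij'
      (fun M _ => (Finset.univ.filter fun a => M a a = true,
        (strictUpper k).filter fun p => M p.1 p.2 = true))
      (fun q _ => ofParts q) ?_ ?_ ?_ hparts
    · intro M hM
      simp only [Finset.mem_filter, Finset.mem_univ, true_and] at hM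
      simp only [T, Finset.mem_filter, Finset.mem_product, Finset.mem_univ, true_and,
        Finset.mem_powerset]
      exact ⟨Finset.filter_subset _ _, by rw [← numOnes_eq_of_symmetric hM.1, hM.2]⟩
    · intro q hq
      simp only [Finset.mem_filter, Finset.mem_univ, true_and]
      have h := Prod.ext_iff.1 (hparts q hq)
      refine ⟨hsymm q, ?_⟩
      refine (numOnes_eq_of_symmetric (hsymm q)).trans ?_
      have h1 := congrArg Finset.card h.1
      have h2 := congrArg Finset.card h.2
      have h3 := (Finset.mem_filter.1 hq).2
      dsimp only at h1 h2 h3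
      lia
    · intro M hM
      simp only [Finset.mem_filter, Finset.mem_univ, true_and] at hM
      ext a b
      simp only [ofParts, Finset.mem_filter, Finset.mem_univ, true_and, mem_strictUpper]
      rcases lt_trichotomy a b with h | rfl | h
      · simp [h, h.ne, h.not_gt]
      · simp
      · simp [h, h.ne', h.not_gt, hM.1 a b]
  rw [hcard, Finset.card_eq_sum_card_fiberwise (t := involutionTypes n)
    (f := fun q => (q.1.card, q.2.card))]
  · refine Finset.sum_congr rfl fun p hp => ?_
    have hp := mem_involutionTypes.1 hp
    have : T.filter (fun q => (q.1.card, q.2.card) = p) =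
        Finset.powersetCard p.1 Finset.univ ×ˢ Finset.powersetCard p.2 (strictUpper k) := by
      ext q
      simp only [T, Finset.mem_filter, Finset.mem_product, Finset.mem_univ, true_and,
        Finset.mem_powerset, Finset.mem_powersetCard, Finset.subset_univ, Prod.ext_iff]
      constructor
      · rintro ⟨⟨h1, _⟩, h2, h3⟩
        exact ⟨h2, h1, h3⟩
      · rintro ⟨h2, h1, h3⟩
        exact ⟨⟨h1, by rw [h2, h3, hp]⟩, h2, h3⟩
    rw [this, Finset.card_product, Finset.card_powersetCard, Finset.card_powersetCard,
      card_strictUpper, Finset.card_fin]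
  · intro q hq
    simp only [T, Finset.coe_filter, Set.mem_ofPred_eq] at hq
    simpa [mem_involutionTypes] using hq.2

lemma choose_mul_choose_eq {n k : ℕ} {p : ℕ × ℕ} (hk : k ≠ 0) (hp : p ∈ involutionTypes n) :
    ((k.choose p.1 : ℝ) * ((k.choose 2).choose p.2 : ℝ)) =
      (k : ℝ) ^ n * (involutionWeight p * symRatio k p.1 p.2) := by
  have hk' : (k : ℝ) ≠ 0 := by exact_mod_cast hk
  rw [← mem_involutionTypes.1 hp, involutionWeight, symRatio,
    Nat.descFactorial_eq_factorial_mul_choose, Nat.descFactorial_eq_factorial_mul_choose,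
    pow_add, pow_mul, div_pow]
  push_cast
  field_simp

lemma sSym_div_two_pow_eq {n : ℕ} (hn : n ≠ 0) (k : ℕ) :
    (sSym k n : ℝ) / 2 ^ (k + 1) = geomWeight n k * symAverage n k := by
  have h : (sSym k n : ℝ) = (k : ℝ) ^ n * symAverage n k := by
    rw [sSym_eq_sum_involutionTypes, symAverage, Finset.mul_sum, Nat.cast_sum]
    refine Finset.sum_congr rfl fun p hp => ?_
    rw [Nat.cast_mul]
    rcases eq_or_ne k 0 with rfl | hk
    · have h0 : p.1 ≠ 0 ∨ p.2 ≠ 0 := by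
        have := mem_involutionTypes.1 hp
        lia
      rw [Nat.cast_zero, zero_pow hn, zero_mul]
      rcases h0 with h0 | h0 <;> simp [Nat.choose_eq_zero_of_lt (Nat.pos_of_ne_zero h0)]
    · exact choose_mul_choose_eq hk hp
  rw [h, geomWeight]
  ring

lemma S11_eq_tsum {n : ℕ} (hn : n ≠ 0) :
    (S11 n : ℝ) = ∑' k, geomWeight n k * symAverage n k := by
  rw [← (hasSum_sSym n).tsum_eq]
  exact tsum_congr fun k => sSym_div_two_pow_eq hn k

/-- `S₁₁(n) ∼ C_s · I(n)·P(n)/n!` with `C_s = (1/2)e^{-(log 2)²/4}`. -/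
theorem S11_asymptotics :
    Filter.Tendsto (fun n : ℕ =>
      (S11 n : ℝ) /
        ((1 / 2 * Real.exp (-(Real.log 2) ^ 2 / 4)) *
          (numInvolutions n : ℝ) * (numPreorders n : ℝ) / (n.factorial : ℝ)))
      Filter.atTop (nhds 1) := by
  have hC : Real.exp (-(Real.log 2 + Real.log 2 ^ 2 / 4)) =
      1 / 2 * Real.exp (-(Real.log 2) ^ 2 / 4) := by
    rw [neg_add, Real.exp_add, Real.exp_neg, Real.exp_log two_pos, neg_div]
    norm_num
  have h := tendsto_tsum_symAverage
  rw [hC] at h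
  have hpos : (0 : ℝ) < 1 / 2 * Real.exp (-(Real.log 2) ^ 2 / 4) := by positivity
  have h1 := h.div_const (1 / 2 * Real.exp (-(Real.log 2) ^ 2 / 4))
  rw [div_self hpos.ne'] at h1
  refine h1.congr' ?_
  filter_upwards [Filter.eventually_ne_atTop 0] with n hn
  have hf : (n.factorial : ℝ) ≠ 0 := by positivity
  rw [S11_eq_tsum hn, numInvolutions_eq, numPreorders_eq_geomSum, div_div]
  congr 1
  field_simp
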